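/- Let T be a string, c a character, and suppose aub ∈ NUS(cT) \ NUS(T) is a net unique substring of cT that is not a prefix of cT, where a, b, c are characters and u is a (possibly empty) string. Then u = lrPref(cT) and #occ_{cT}(u) = 2. -/

import Mathlib

open List

/-- Number of occurrences of `w` in `T`, i.e. the number of (1-indexed) intervals
`[i..j]` with `T[i..j] = w`.  The empty string has `T.length + 1` occurrences. -/
def countOcc {α : Type*} [DecidableEq α] (T w : List α) : ℕ :=
  ((Finset.range (T.length + 1)).filter
    (fun i => i + w.length ≤ T.length ∧ (T.drop i).take w.length = w)).card

/-- `w` is unique in `T`: it has exactly one occurrence. -/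
def uniqueIn {α : Type*} [DecidableEq α] (T w : List α) : Prop := countOcc T w = 1

/-- `w` is repeating (a repeat) in `T`: it has at least two occurrences. -/
def repeatingIn {α : Type*} [DecidableEq α] (T w : List α) : Prop := 2 ≤ countOcc T w

/-- `w` is quasi-unique in `T`: it has one or two occurrences. -/
def quasiUniqueIn {α : Type*} [DecidableEq α] (T w : List α) : Prop :=
  1 ≤ countOcc T w ∧ countOcc T w ≤ 2

/-- The (1-indexed) substring `T[i..j]`; `T[i..i-1]` is the empty string. -/
def substr {α : Type*} (T : List α) (i j : ℕ) : List α := (T.drop (i - 1)).take (j + 1 - i)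

/-- `[i..j]` (1-indexed, possibly empty with `j = i - 1`) is a net occurrence in `T`:
`2 ≤ i`, `j ≤ |T| - 1`, `T[i..j]` is repeating in `T`, and both `T[i-1..j]` and
`T[i..j+1]` are unique in `T`. -/
def NetOcc {α : Type*} [DecidableEq α] (T : List α) (i j : ℕ) : Prop :=
  2 ≤ i ∧ i - 1 ≤ j ∧ j + 1 ≤ T.length ∧
  repeatingIn T (substr T i j) ∧ uniqueIn T (substr T (i - 1) j) ∧
  uniqueIn T (substr T i (j + 1))

/-- The set of net unique substrings of `T`: the strings `T[i-1..j+1]` for net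
occurrences `[i..j]`. -/
def NUS {α : Type*} [DecidableEq α] (T : List α) : Set (List α) :=
  {w | ∃ i j, NetOcc T i j ∧ w = substr T (i - 1) (j + 1)}

/-- The set of extended net occurrences of `T`: the intervals `[i-1..j+1]` for net
occurrences `[i..j]`. -/
def ENO {α : Type*} [DecidableEq α] (T : List α) : Set (ℕ × ℕ) :=
  {p | 1 ≤ p.2 ∧ NetOcc T (p.1 + 1) (p.2 - 1)}

/-- The set of minimal unique substring (MUS) occurrences `[i..j]` in `T`:
`T[i..j]` is unique in `T` while `T[i+1..j]` and `T[i..j-1]` are repeating in `T`. -/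
def MUS {α : Type*} [DecidableEq α] (T : List α) : Set (ℕ × ℕ) :=
  {p | 1 ≤ p.1 ∧ p.1 ≤ p.2 ∧ p.2 ≤ T.length ∧ uniqueIn T (substr T p.1 p.2) ∧
       repeatingIn T (substr T (p.1 + 1) p.2) ∧ repeatingIn T (substr T p.1 (p.2 - 1))}

/-- `w` is the longest repeating suffix `lrSuf(T)` of `T`. -/
def IsLrSuf {α : Type*} [DecidableEq α] (T w : List α) : Prop :=
  w <:+ T ∧ repeatingIn T w ∧ ∀ v, v <:+ T → repeatingIn T v → v.length ≤ w.length

/-- `w` is the shortest quasi-unique suffix `sqSuf(T)` of `T`. -/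
def IsSqSuf {α : Type*} [DecidableEq α] (T w : List α) : Prop :=
  w <:+ T ∧ quasiUniqueIn T w ∧ ∀ v, v <:+ T → quasiUniqueIn T v → w.length ≤ v.length

/-- `w` is the longest repeating prefix `lrPref(T)` of `T`. -/
def IsLrPref {α : Type*} [DecidableEq α] (T w : List α) : Prop :=
  w <+: T ∧ repeatingIn T w ∧ ∀ v, v <+: T → repeatingIn T v → v.length ≤ w.length

/-- `w` is the shortest quasi-unique prefix `sqPref(T)` of `T`. -/
def IsSqPref {α : Type*} [DecidableEq α] (T w : List α) : Prop :=
  w <+: T ∧ quasiUniqueIn T w ∧ ∀ v, v <+: T → quasiUniqueIn T v → w.length ≤ v.length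

/-- Positions at which `w` occurs, via prefixes of drops. -/
theorem mem_occ_iff {α : Type*} (T w : List α) (i : ℕ) :
    (i ∈ Finset.range (T.length + 1) ∧ (i + w.length ≤ T.length ∧ (T.drop i).take w.length = w)) ↔
      (i ≤ T.length ∧ w <+: T.drop i) := by
  rw [Finset.mem_range, List.prefix_iff_eq_take]
  constructor
  · rintro ⟨h, h', h''⟩
    exact ⟨by omega, h''.symm⟩
  · rintro ⟨h, h'⟩
    have := congrArg List.length h'
    simp only [List.length_take, List.length_drop] at this
    exact ⟨by omega, by omega, h'.symm⟩

theorem countOcc_eq {α : Type*} [DecidableEq α] (T w : List α) :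
    countOcc T w = ((Finset.range (T.length + 1)).filter (fun i => w <+: T.drop i)).card := by
  unfold countOcc
  congr 1
  ext i
  rw [Finset.mem_filter, mem_occ_iff, Finset.mem_filter, Finset.mem_range, Nat.lt_succ_iff]

theorem countOcc_cons {α : Type*} [DecidableEq α] (T w : List α) (c : α) :
    countOcc (c :: T) w = countOcc T w + if w <+: c :: T then 1 else 0 := by
  rw [countOcc_eq, countOcc_eq, Finset.card_filter, Finset.card_filter]
  rw [List.length_cons, Finset.sum_range_succ']
  simp

theorem countOcc_pos_of_infix {α : Type*} [DecidableEq α] {T w : List α} (h : w <:+: T) :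
    1 ≤ countOcc T w := by
  obtain ⟨s, t, rfl⟩ := h
  rw [countOcc_eq, Nat.one_le_iff_ne_zero, ← Nat.pos_iff_ne_zero, Finset.card_pos]
  refine ⟨s.length, ?_⟩
  simp

theorem infix_of_countOcc_pos {α : Type*} [DecidableEq α] {T w : List α} (h : 1 ≤ countOcc T w) :
    w <:+: T := by
  rw [countOcc_eq, Nat.one_le_iff_ne_zero, ← Nat.pos_iff_ne_zero, Finset.card_pos] at h
  obtain ⟨i, hi⟩ := h
  rw [Finset.mem_filter] at hi
  exact hi.2.isInfix.trans (List.drop_suffix i T).isInfix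

theorem ext_eq {α : Type*} [DecidableEq α] {T u : List α} {x y : α} (h : countOcc T u ≤ 1)
    (hx : u ++ [x] <:+: T) (hy : u ++ [y] <:+: T) : x = y := by
  obtain ⟨s, t, h1⟩ := hx
  obtain ⟨s', t', h2⟩ := hy
  rw [countOcc_eq, Finset.card_le_one] at h
  have e1 : T.drop s.length = u ++ [x] ++ t := by rw [← h1]; simp
  have e2 : T.drop s'.length = u ++ [y] ++ t' := by rw [← h2]; simp
  have l1 : s.length ≤ T.length := by rw [← h1]; simp only [List.length_append]; omega
  have l2 : s'.length ≤ T.length := by rw [← h2]; simp only [List.length_append]; omega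
  have := h s.length (by rw [Finset.mem_filter, Finset.mem_range, e1]; exact ⟨by omega, by simp⟩)
    s'.length (by rw [Finset.mem_filter, Finset.mem_range, e2]; exact ⟨by omega, by simp⟩)
  rw [this, e2] at e1
  simp at e1
  exact e1.1.symm

theorem mem_NUS_iff {α : Type*} [DecidableEq α] (T : List α) (a b : α) (u : List α) :
    (a :: u ++ [b]) ∈ NUS T ↔ (a :: u ++ [b]) <:+: T ∧ repeatingIn T u ∧
      uniqueIn T (a :: u) ∧ uniqueIn T (u ++ [b]) := by
  constructor
  · rintro ⟨i, j, ⟨hi, hij, hj, hr, hu1, hu2⟩, hw⟩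
    have hsplit : ∃ s t, T = s ++ (a :: u ++ [b]) ++ t ∧ s.length = i - 2 := by
      refine ⟨T.take (i - 2), (T.drop (i - 2)).drop (j + 1 + 1 - (i - 1)), ?_, ?_⟩
      · rw [hw, substr, show i - 1 - 1 = i - 2 by omega, List.append_assoc,
          List.take_append_drop, List.take_append_drop]
      · rw [List.length_take]; omega
    obtain ⟨s, t, hT, hs⟩ := hsplit
    have hlen := congrArg List.length hw
    simp only [substr, List.length_append, List.length_cons, List.length_take, List.length_drop,
      List.length_nil] at hlen
    have hjl : j = i - 1 + u.length := by omega
    obtain ⟨k, rfl⟩ : ∃ k, i = k + 2 := ⟨i - 2, by omega⟩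
    have hk : s.length = k := by omega
    have d1 : T.drop k = a :: u ++ [b] ++ t := by rw [hT, ← hk]; simp
    have d2 : T.drop (k + 1) = u ++ [b] ++ t := by rw [← List.tail_drop, d1]; simp
    have e1 : substr T (k + 2) j = u := by
      rw [substr, show k + 2 - 1 = k + 1 by omega, d2, show j + 1 - (k + 2) = u.length by omega]
      simp
    have e2 : substr T (k + 2 - 1) j = a :: u := by
      rw [substr, show k + 2 - 1 - 1 = k by omega, d1,
        show j + 1 - (k + 2 - 1) = u.length + 1 by omega]
      simp
    have e3 : substr T (k + 2) (j + 1) = u ++ [b] := by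
      rw [substr, show k + 2 - 1 = k + 1 by omega, d2,
        show j + 1 + 1 - (k + 2) = (u ++ [b]).length by simp; omega]
      exact List.take_left
    rw [e1] at hr
    rw [e2] at hu1
    rw [e3] at hu2
    exact ⟨⟨s, t, hT.symm⟩, hr, hu1, hu2⟩
  · rintro ⟨⟨s, t, hT⟩, hr, hu1, hu2⟩
    obtain ⟨k, hk⟩ : ∃ k, s.length = k := ⟨_, rfl⟩
    have d1 : T.drop k = a :: u ++ [b] ++ t := by rw [← hT, ← hk]; simp
    have d2 : T.drop (k + 1) = u ++ [b] ++ t := by rw [← List.tail_drop, d1]; simp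
    obtain ⟨j, hj⟩ : ∃ j, j = k + 1 + u.length := ⟨_, rfl⟩
    have e1 : substr T (k + 2) j = u := by
      rw [substr, show k + 2 - 1 = k + 1 by omega, d2, show j + 1 - (k + 2) = u.length by omega]
      simp
    have e2 : substr T (k + 2 - 1) j = a :: u := by
      rw [substr, show k + 2 - 1 - 1 = k by omega, d1,
        show j + 1 - (k + 2 - 1) = u.length + 1 by omega]
      simp
    have e3 : substr T (k + 2) (j + 1) = u ++ [b] := by
      rw [substr, show k + 2 - 1 = k + 1 by omega, d2,
        show j + 1 + 1 - (k + 2) = (u ++ [b]).length by simp; omega]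
      exact List.take_left
    have e4 : substr T (k + 2 - 1) (j + 1) = a :: u ++ [b] := by
      rw [substr, show k + 2 - 1 - 1 = k by omega, d1,
        show j + 1 + 1 - (k + 2 - 1) = (a :: u ++ [b]).length by simp; omega]
      exact List.take_left
    refine ⟨k + 2, j, ⟨by omega, by omega, ?_, ?_, ?_, ?_⟩, e4.symm⟩
    · have := congrArg List.length hT
      simp only [List.length_append, List.length_cons, List.length_nil] at this
      omega
    · rwa [e1]
    · rwa [e2]
    · rwa [e3]

/-- If `aub ∈ NUS(cT) \ NUS(T)` is not a prefix of `cT`, then `u = lrPref(cT)` and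
`#occ_{cT}(u) = 2`. -/
theorem added_net_occurrence_nonprefix {α : Type*} [DecidableEq α] (T : List α)
    (a b c : α) (u : List α)
    (h1 : (a :: u ++ [b]) ∈ NUS (c :: T)) (h2 : (a :: u ++ [b]) ∉ NUS T)
    (h3 : ¬ (a :: u ++ [b]) <+: (c :: T)) :
    IsLrPref (c :: T) u ∧ countOcc (c :: T) u = 2 := by
  rw [mem_NUS_iff] at h1 h2
  obtain ⟨hin, hr, hu1, hu2⟩ := h1
  have hinT : (a :: u ++ [b]) <:+: T := by
    rcases List.infix_cons_iff.1 hin with h | h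
    · exact absurd h h3
    · exact h
  have i1 : (a :: u) <:+: T := (List.prefix_append (a :: u) [b]).isInfix.trans hinT
  have i2 : (u ++ [b]) <:+: T :=
    (show (u ++ [b]) <:+ (a :: u ++ [b]) from List.suffix_cons a (u ++ [b])).isInfix.trans hinT
  have p1 := countOcc_pos_of_infix i1
  have p2 := countOcc_pos_of_infix i2
  unfold uniqueIn at hu1 hu2
  have c1 := countOcc_cons T (a :: u) c
  have c2 := countOcc_cons T (u ++ [b]) c
  have c3 := countOcc_cons T u c
  have hT1 : uniqueIn T (a :: u) := by unfold uniqueIn; omega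
  have hT2 : uniqueIn T (u ++ [b]) := by unfold uniqueIn; omega
  have hle : countOcc T u ≤ 1 := by
    by_contra hcon
    exact h2 ⟨hinT, by unfold repeatingIn; omega, hT1, hT2⟩
  have hr' := hr
  unfold repeatingIn at hr'
  have hpre : u <+: c :: T := by
    by_contra hcon
    rw [if_neg hcon] at c3
    omega
  rw [if_pos hpre] at c3
  refine ⟨⟨hpre, hr, ?_⟩, by omega⟩
  intro v hv hvr
  by_contra hlen
  obtain ⟨w, rfl⟩ := List.prefix_of_prefix_length_le hpre hv (by omega)
  cases w with
  | nil => simp at hlen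
  | cons x w =>
    have hux : u ++ [x] <+: u ++ x :: w := ⟨w, by simp⟩
    have c4 := countOcc_cons T (u ++ x :: w) c
    rw [if_pos hv] at c4
    unfold repeatingIn at hvr
    have hxT : u ++ [x] <:+: T :=
      hux.isInfix.trans (infix_of_countOcc_pos (by omega))
    have hxb := ext_eq hle hxT i2
    subst hxb
    rw [if_pos (hux.trans hv)] at c2
    omega
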